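/- (A₁ = I₁I₂ is unipotent parabolic at θ = 5π/6.) In the ℂ³ setting, the matrix A₁ = I₁·I₂ satisfies det A₁ = 1, trace A₁ = 3, A₁ ≠ Id and (A₁ − Id)³ = 0 (so A₁ is a nontrivial unipotent element), and A₁·q₁₂ = q₁₂ where q₁₂ = ((−1+i)/(√2·√(√3+1)), 1, (1+i)/(√2·√(√3−1)))ᵗ is a null vector: ⟨q₁₂,q₁₂⟩ = 0. -/

import Mathlib

open Complex ComplexConjugate Matrix

noncomputable section

/-- Signature (2,1) weights of the Hermitian form `H = diag(1,1,-1)`. -/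
def eta3 : Fin 3 → ℂ := ![1, 1, -1]

/-- The Hermitian form `⟨z,w⟩ = z₁ conj w₁ + z₂ conj w₂ - z₃ conj w₃`. -/
def herm3 (z w : Fin 3 → ℂ) : ℂ :=
  z 0 * conj (w 0) + z 1 * conj (w 1) - z 2 * conj (w 2)

/-- The (real) value `⟨z,z⟩` of the Hermitian form. -/
def q3 (z : Fin 3 → ℂ) : ℝ :=
  Complex.normSq (z 0) + Complex.normSq (z 1) - Complex.normSq (z 2)

/-- The order-4 symmetry `J = diag(-1, -i, 1)`. -/
def J3 : Matrix (Fin 3) (Fin 3) ℂ := Matrix.diagonal ![-1, -Complex.I, 1]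

/-- The polar vector `n₁` at `θ = 5π/6`. -/
def n1w : Fin 3 → ℂ :=
  ![((Real.sqrt (1 + Real.sqrt 3) / 2 : ℝ) : ℂ),
    ((Real.sqrt 2 / 2 : ℝ) : ℂ),
    ((Real.sqrt (Real.sqrt 3 - 1) / 2 : ℝ) : ℂ)]

/-- `nw k` is the vector `n_{k+1}`, i.e. `J^k n₁`. -/
def nw (k : Fin 4) : Fin 3 → ℂ := (J3 ^ (k : ℕ)).mulVec n1w

/-- The matrix of the order-two complex reflection `z ↦ -z + 2⟨z,n⟩ n`. -/
def refl3 (n : Fin 3 → ℂ) : Matrix (Fin 3) (Fin 3) ℂ :=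
  -(1 : Matrix (Fin 3) (Fin 3) ℂ) +
    (2 : ℂ) • Matrix.vecMulVec n (fun k => conj (n k) * eta3 k)

/-- `Iw k` is the complex reflection `I_{k+1}`. -/
def Iw (k : Fin 4) : Matrix (Fin 3) (Fin 3) ℂ := refl3 (nw k)

/-- `Aw k` is `A_{k+1} = I_{k+1} · I_{k+2}` (indices mod 4). -/
def Aw (k : Fin 4) : Matrix (Fin 3) (Fin 3) ℂ := Iw k * Iw (k + 1)

/-- The Dirichlet center `p₀ = (0,0,1)ᵗ`. -/
def p0w : Fin 3 → ℂ := ![0, 0, 1]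

/-- `pw i j` is `p_{(i+1)(j+1)} = I_{i+1} I_{j+1} p₀`. -/
def pw (i j : Fin 4) : Fin 3 → ℂ := (Iw i * Iw j).mulVec p0w

/-- The parabolic fixed point `q₁₂` of `A₁ = I₁I₂` on the ideal boundary. -/
def q12w : Fin 3 → ℂ :=
  ![(-1 + Complex.I) / ((Real.sqrt 2 * Real.sqrt (Real.sqrt 3 + 1) : ℝ) : ℂ),
    1,
    (1 + Complex.I) / ((Real.sqrt 2 * Real.sqrt (Real.sqrt 3 - 1) : ℝ) : ℂ)]

def nn (a b c : ℂ) : Matrix (Fin 3) (Fin 3) ℂ :=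
  !![a*a, a*b, -(a*c); b*a, b*b, -(b*c); c*a, c*b, -(c*c)]

def mm (a b c : ℂ) : Matrix (Fin 3) (Fin 3) ℂ :=
  !![a*a, -(I*a*b), a*c; I*a*b, b*b, I*b*c; -(c*a), I*c*b, -(c*c)]

theorem nm_facts (a b c s : ℂ) (ha : a^2 = (1+s)/4) (hb : b^2 = 1/2) (hc : c^2 = (s-1)/4)
    (hs : s^2 = 3) :
    nn a b c * nn a b c = nn a b c ∧ mm a b c * mm a b c = mm a b c ∧
    nn a b c * mm a b c * nn a b c = nn a b c ∧ mm a b c * nn a b c * mm a b c = mm a b c := by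
  have hI : I^2 = -1 := I_sq
  have key : ∀ x y : Fin 3 → ℂ, ∀ u v : Fin 3 → ℂ, vecMulVec x y * vecMulVec u v
      = (y ⬝ᵥ u) • vecMulVec x v := by
    intro x y u v
    rw [Matrix.vecMulVec_mul_vecMulVec]
    ext i j; simp [vecMulVec_apply]; try ring
  have hn : nn a b c = vecMulVec ![a,b,c] ![a,b,-c] := by
    ext i j; fin_cases i <;> fin_cases j <;> simp [nn, vecMulVec_apply]
  have hm : mm a b c = vecMulVec ![-a,-(I*b),c] ![-a,I*b,-c] := by
    ext i j; fin_cases i <;> fin_cases j <;> simp [mm, vecMulVec_apply] <;>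
      first | ring1 | linear_combination (b*b) * hI
  have e1 : ![a,b,-c] ⬝ᵥ ![a,b,c] = 1 := by
    simp [dotProduct, Fin.sum_univ_three]; linear_combination ha + hb - hc
  have e2 : ![-a,I*b,-c] ⬝ᵥ ![-a,-(I*b),c] = 1 := by
    simp [dotProduct, Fin.sum_univ_three]; linear_combination ha + hb - hc - b^2 * hI
  have e3 : ![a,b,-c] ⬝ᵥ ![-a,-(I*b),c] = -s/2 - I/2 := by
    simp [dotProduct, Fin.sum_univ_three]; linear_combination -ha - I*hb - hc
  have e4 : ![-a,I*b,-c] ⬝ᵥ ![a,b,c] = -s/2 + I/2 := by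
    simp [dotProduct, Fin.sum_univ_three]; linear_combination -ha + I*hb - hc
  have e5 : (-s/2 - I/2) * (-s/2 + I/2) = 1 := by linear_combination hs/4 - hI/4
  have e6 : (-s/2 + I/2) * (-s/2 - I/2) = 1 := by linear_combination hs/4 - hI/4
  rw [hn, hm]
  refine ⟨?_, ?_, ?_, ?_⟩
  · rw [key, e1, one_smul]
  · rw [key, e2, one_smul]
  · rw [key, smul_mul_assoc, key, e3, e4, smul_smul, e5, one_smul]
  · rw [key, smul_mul_assoc, key, e3, e4, smul_smul, e6, one_smul]

theorem unip {R : Type*} [Ring R] (N M : R) (h1 : N * N = N) (h2 : M * M = M)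
    (h3 : N * M * N = N) (h4 : M * N * M = M) :
    ((-1 + 2 * N) * (-1 + 2 * M) - 1) ^ 3 = 0 := by
  have hX : (-1 + 2 * N) * (-1 + 2 * M) - 1 = 4 * (N * M) - 2 * N - 2 * M := by noncomm_ring
  have hY : (4 * (N * M) - 2 * N - 2 * M) * (4 * (N * M) - 2 * N - 2 * M)
      = 4 * (N * M + M * N - N - M) := by
    have : (4 * (N * M) - 2 * N - 2 * M) * (4 * (N * M) - 2 * N - 2 * M)
      = 16 * ((N * M * N) * M) - 8 * (N * M * N) - 8 * (N * (M * M)) - 8 * ((N * N) * M)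
        + 4 * (N * N) + 4 * (N * M) - 8 * (M * N * M) + 4 * (M * N) + 4 * (M * M) := by
      noncomm_ring
    rw [this, h1, h2, h3, h4]; noncomm_ring
  have hNY : N * (N * M + M * N - N - M) = 0 := by
    have : N * (N * M + M * N - N - M) = N * N * M + N * M * N - N * N - N * M := by noncomm_ring
    rw [this, h1, h3]; noncomm_ring
  have hMY : M * (N * M + M * N - N - M) = 0 := by
    have : M * (N * M + M * N - N - M) = M * N * M + M * M * N - M * N - M * M := by noncomm_ring
    rw [this, h2, h4]; noncomm_ring
  rw [hX, pow_succ', pow_two, hY]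
  have : (4 * (N * M) - 2 * N - 2 * M) * (4 * (N * M + M * N - N - M))
    = 4 * (4 * (N * (M * (N * M + M * N - N - M))) - 2 * (N * (N * M + M * N - N - M))
      - 2 * (M * (N * M + M * N - N - M))) := by noncomm_ring
  rw [this, hNY, hMY]; simp

theorem A_eq (a b c : ℂ) (ha : a = ((Real.sqrt (1 + Real.sqrt 3) / 2 : ℝ) : ℂ))
    (hb : b = ((Real.sqrt 2 / 2 : ℝ) : ℂ))
    (hc : c = ((Real.sqrt (Real.sqrt 3 - 1) / 2 : ℝ) : ℂ)) :
    Aw 0 = (-1 + 2 * nn a b c) * (-1 + 2 * mm a b c) := by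
  have ca : conj a = a := by rw [ha, conj_ofReal]
  have cb : conj b = b := by rw [hb, conj_ofReal]
  have cc : conj c = c := by rw [hc, conj_ofReal]
  have h1 : n1w = ![a, b, c] := by rw [ha, hb, hc]; rfl
  have n0 : nw 0 = ![a, b, c] := by simp [nw, h1]
  have n1 : nw 1 = ![-a, -(I * b), c] := by
    ext i; fin_cases i <;> simp [nw, h1, J3, mulVec_diagonal]
  have t : ∀ X : Matrix (Fin 3) (Fin 3) ℂ, 2 * X = (2 : ℂ) • X := by
    intro X; rw [two_mul, two_smul]
  have r0 : Iw 0 = -1 + 2 * nn a b c := by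
    rw [Iw, refl3, n0, t]; congr 2
    ext i j; fin_cases i <;> fin_cases j <;> simp [nn, vecMulVec_apply, eta3, ca, cb, cc]
  have r1 : Iw 1 = -1 + 2 * mm a b c := by
    rw [Iw, refl3, n1, t]; congr 2
    ext i j; fin_cases i <;> fin_cases j <;> simp [mm, vecMulVec_apply, eta3, ca, cb, cc] <;>
      first | ring1 | linear_combination (-b*b) * I_sq
  rw [Aw, r0]; congr 1

theorem main_aux (a b c s r : ℂ) (ha : a^2 = (1+s)/4) (hr : r = 2 * b) (hb : b^2 = 1/2)
    (hc : c^2 = (s-1)/4) (hs : s^2 = 3) (ha0 : a ≠ 0) (hb0 : b ≠ 0) (hc0 : c ≠ 0)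
    (A : Matrix (Fin 3) (Fin 3) ℂ) (hA : A = (-1 + 2 * nn a b c) * (-1 + 2 * mm a b c)) :
    A.det = 1 ∧ A.trace = 3 ∧ A ≠ 1 ∧ (A - 1) ^ 3 = 0 ∧
    A.mulVec ![(-1 + I) / (r * (2 * a)), 1, (1 + I) / (r * (2 * c))] =
      ![(-1 + I) / (r * (2 * a)), 1, (1 + I) / (r * (2 * c))] := by
  have hI : I^2 = -1 := I_sq
  have t : ∀ X : Matrix (Fin 3) (Fin 3) ℂ, 2 * X = (2 : ℂ) • X := by
    intro X; rw [two_mul, two_smul]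
  have X1 : (-1 + 2 * nn a b c) = !![-1 + 2*(a*a), 2*(a*b), -(2*(a*c)); 2*(b*a), -1+2*(b*b),
      -(2*(b*c)); 2*(c*a), 2*(c*b), -1-2*(c*c)] := by
    rw [t]; ext i j; fin_cases i <;> fin_cases j <;> simp [nn] <;> ring
  have X2 : (-1 + 2 * mm a b c) = !![-1 + 2*(a*a), -(2*(I*a*b)), 2*(a*c); 2*(I*a*b), -1+2*(b*b),
      2*(I*b*c); -(2*(c*a)), 2*(I*c*b), -1-2*(c*c)] := by
    rw [t]; ext i j; fin_cases i <;> fin_cases j <;> simp [mm] <;> ring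
  have hs1 : s ≠ 1 := by rintro rfl; norm_num at hs
  refine ⟨?_, ?_, ?_, ?_, ?_⟩
  · rw [hA, det_mul, X1, X2]
    have d1 : det !![-1 + 2*(a*a), 2*(a*b), -(2*(a*c)); 2*(b*a), -1+2*(b*b),
      -(2*(b*c)); 2*(c*a), 2*(c*b), -1-2*(c*c)] = 1 := by
      simp [det_fin_three]; linear_combination 2*ha + 2*hb - 2*hc
    have d2 : det !![-1 + 2*(a*a), -(2*(I*a*b)), 2*(a*c); 2*(I*a*b), -1+2*(b*b),
      2*(I*b*c); -(2*(c*a)), 2*(I*c*b), -1-2*(c*c)] = 1 := by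
      simp [det_fin_three]
      ring_nf
      simp only [hI]
      linear_combination 2*ha + 2*hb - 2*hc
    rw [d1, d2, one_mul]
  · rw [hA, X1, X2]
    simp [trace_fin_three, mul_apply, Fin.sum_univ_three]
    ring_nf
    rw [show a^4 = (a^2)^2 by ring, show b^4 = (b^2)^2 by ring, show c^4 = (c^2)^2 by ring]
    simp only [ha, hb, hc]
    ring_nf
    rw [hs]; try ring
  · intro h
    have h01 := congrFun (congrFun h 0) 1
    rw [hA, X1, X2] at h01
    simp [mul_apply, Fin.sum_univ_three] at h01
    have : 2 * a * b * I * (1 - s) = 0 := by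
      linear_combination h01 + (4*a*b*I)*ha - 4*a*b*hb + 4*a*b*I*hc
    simp [ha0, hb0, sub_eq_zero] at this
    exact hs1 this.symm
  · obtain ⟨h1, h2, h3, h4⟩ := nm_facts a b c s ha hb hc hs
    rw [hA]; exact unip _ _ h1 h2 h3 h4
  · have q0 : (-1 + I) / (r * (2 * a)) = (-1+I) * b / (2 * a) := by
      rw [hr]; field_simp; linear_combination (-(-1+I)*2)*hb
    have q2 : (1 + I) / (r * (2 * c)) = (1+I) * b / (2 * c) := by
      rw [hr]; field_simp; linear_combination (-(1+I)*2)*hb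
    have v1 : (-1 + 2 * nn a b c).mulVec ![(-1+I) * b / (2 * a), 1, (1+I) * b / (2 * c)]
        = -![(-1+I) * b / (2 * a), 1, (1+I) * b / (2 * c)] := by
      rw [X1]; ext i; fin_cases i <;> simp [mulVec, dotProduct, Fin.sum_univ_three] <;>
        field_simp <;> ring
    have v2 : (-1 + 2 * mm a b c).mulVec ![(-1+I) * b / (2 * a), 1, (1+I) * b / (2 * c)]
        = -![(-1+I) * b / (2 * a), 1, (1+I) * b / (2 * c)] := by
      rw [X2]; ext i; fin_cases i <;> simp [mulVec, dotProduct, Fin.sum_univ_three] <;>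
        field_simp <;> ring_nf <;> simp only [hI] <;> ring
    rw [hA, q0, q2, ← mulVec_mulVec, v2, mulVec_neg, v1, neg_neg]

/-- at `θ = 5π/6`, the matrix `A₁ = I₁I₂` is a nontrivial unipotent
(parabolic) element: `det A₁ = 1`, `tr A₁ = 3`, `A₁ ≠ Id`, `(A₁ - Id)³ = 0`,
and `A₁` fixes the null vector `q₁₂` (with `⟨q₁₂,q₁₂⟩ = 0`). -/
theorem A1_unipotent_parabolic_2dim :
    (Aw 0).det = 1 ∧
    (Aw 0).trace = 3 ∧
    Aw 0 ≠ 1 ∧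
    (Aw 0 - 1) ^ 3 = 0 ∧
    (Aw 0).mulVec q12w = q12w ∧
    herm3 q12w q12w = 0 := by
  have hs3 : Real.sqrt 3 ^ 2 = 3 := Real.sq_sqrt (by norm_num)
  have hs1 : 1 < Real.sqrt 3 := by
    rw [Real.lt_sqrt] <;> norm_num
  have pa : 0 < Real.sqrt (1 + Real.sqrt 3) := Real.sqrt_pos.2 (by linarith)
  have pb : 0 < Real.sqrt 2 := Real.sqrt_pos.2 (by norm_num)
  have pc : 0 < Real.sqrt (Real.sqrt 3 - 1) := Real.sqrt_pos.2 (by linarith)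
  have sa : Real.sqrt (1 + Real.sqrt 3) ^ 2 = 1 + Real.sqrt 3 := Real.sq_sqrt (by linarith)
  have sb : Real.sqrt 2 ^ 2 = 2 := Real.sq_sqrt (by norm_num)
  have sc : Real.sqrt (Real.sqrt 3 - 1) ^ 2 = Real.sqrt 3 - 1 := Real.sq_sqrt (by linarith)
  have hq : q12w = ![(-1 + I) / (((Real.sqrt 2 : ℝ) : ℂ) *
        (2 * ((Real.sqrt (1 + Real.sqrt 3) / 2 : ℝ) : ℂ))), 1,
      (1 + I) / (((Real.sqrt 2 : ℝ) : ℂ) *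
        (2 * ((Real.sqrt (Real.sqrt 3 - 1) / 2 : ℝ) : ℂ)))] := by
    rw [q12w, add_comm (Real.sqrt 3) 1]
    push_cast
    rw [mul_div_cancel₀ _ (two_ne_zero' ℂ), mul_div_cancel₀ _ (two_ne_zero' ℂ)]
  have hfin : herm3 q12w q12w = 0 := by
    have ea : ((Real.sqrt (Real.sqrt 3 + 1) : ℝ) : ℂ) ^ 2 = (Real.sqrt 3 : ℝ) + 1 := by
      rw [add_comm (Real.sqrt 3) 1]; exact_mod_cast (by rw [sa]; ring)
    have eb : ((Real.sqrt 2 : ℝ) : ℂ) ^ 2 = 2 := by exact_mod_cast sb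
    have ec : ((Real.sqrt (Real.sqrt 3 - 1) : ℝ) : ℂ) ^ 2 = (Real.sqrt 3 : ℝ) - 1 := by
      exact_mod_cast sc
    have es : ((Real.sqrt 3 : ℝ) : ℂ) ^ 2 = 3 := by exact_mod_cast hs3
    have na : ((Real.sqrt 3 : ℝ) : ℂ) + 1 ≠ 0 := by
      exact_mod_cast (by linarith : Real.sqrt 3 + 1 ≠ 0)
    have nc : ((Real.sqrt 3 : ℝ) : ℂ) - 1 ≠ 0 := by
      exact_mod_cast (sub_pos.2 hs1).ne'
    have fa : ((Real.sqrt 2 * Real.sqrt (Real.sqrt 3 + 1) : ℝ) : ℂ) *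
        ((Real.sqrt 2 * Real.sqrt (Real.sqrt 3 + 1) : ℝ) : ℂ) = 2 * ((Real.sqrt 3 : ℝ) + 1) := by
      rw [← pow_two, ofReal_mul, mul_pow, ea, eb]
    have fc : ((Real.sqrt 2 * Real.sqrt (Real.sqrt 3 - 1) : ℝ) : ℂ) *
        ((Real.sqrt 2 * Real.sqrt (Real.sqrt 3 - 1) : ℝ) : ℂ) = 2 * ((Real.sqrt 3 : ℝ) - 1) := by
      rw [← pow_two, ofReal_mul, mul_pow, ec, eb]
    simp only [herm3, q12w, Matrix.cons_val, map_div₀, conj_ofReal, map_add, map_neg, map_one,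
      conj_I, div_mul_div_comm, fa, fc]
    field_simp
    ring_nf
    simp only [I_sq, es]
    ring
  obtain ⟨h1, h2, h3, h4, h5⟩ := main_aux ((Real.sqrt (1 + Real.sqrt 3) / 2 : ℝ) : ℂ)
    ((Real.sqrt 2 / 2 : ℝ) : ℂ) ((Real.sqrt (Real.sqrt 3 - 1) / 2 : ℝ) : ℂ)
    ((Real.sqrt 3 : ℝ) : ℂ) ((Real.sqrt 2 : ℝ) : ℂ)
    (by exact_mod_cast (by rw [div_pow, sa]; norm_num))
    (by push_cast; ring)
    (by exact_mod_cast (by rw [div_pow, sb]; norm_num))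
    (by exact_mod_cast (by rw [div_pow, sc]; norm_num))
    (by exact_mod_cast hs3)
    (by exact_mod_cast (by positivity)) (by exact_mod_cast (by positivity))
    (by exact_mod_cast (by positivity)) (Aw 0) (A_eq _ _ _ rfl rfl rfl)
  rw [← hq] at h5
  exact ⟨h1, h2, h3, h4, h5, hfin⟩
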